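/- arXiv:2410.02035 — 2 statements merged into one kernel-verified Lean document; each statement's English description precedes it below -/
import Mathlib

section
/- Let n be a positive integer, set x_j = −1/2 and y_j = (−1)^j ⌊j/2⌋ π for 1 ≤ j ≤ n, let ξ_j, ζ_j ∈ ℝ be arbitrary, let D ∈ ℝ, and define G̃(s) = Σ_{j=1}^n (ζ_j (s − y_j) − ξ_j x_j)/(x_j² + (s − y_j)²) + D. Then for every B > nπ/2, both V_{−∞}^{−B}(G̃) and V_B^∞(G̃) are at most (Σ_{j=1}^n (ξ_j² + ζ_j²))^{1/2} · √n / (B − nπ/2). -/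
open MeasureTheory Real

/-- If the increments of `f` are dominated by those of a function `φ` with increments at most `K`,
then the total variation of `f` is at most `K`. -/
theorem eVariationOn_le_of_abs_sub_le {f φ : ℝ → ℝ} {s : Set ℝ} {K : ℝ}
    (hf : ∀ a ∈ s, ∀ b ∈ s, a ≤ b → |f b - f a| ≤ φ b - φ a)
    (hφ : ∀ a ∈ s, ∀ b ∈ s, φ b - φ a ≤ K) :
    eVariationOn f s ≤ ENNReal.ofReal K := by
  refine iSup_le fun p => ?_
  obtain ⟨N, u, hu, hus⟩ := p
  calc ∑ i ∈ Finset.range N, edist (f (u (i + 1))) (f (u i))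
      ≤ ∑ i ∈ Finset.range N, ENNReal.ofReal (φ (u (i + 1)) - φ (u i)) := by
        refine Finset.sum_le_sum fun i _ => ?_
        rw [edist_dist, Real.dist_eq]
        exact ENNReal.ofReal_le_ofReal (hf _ (hus i) _ (hus (i + 1)) (hu (Nat.le_succ i)))
    _ = ENNReal.ofReal (φ (u N) - φ (u 0)) := by
        rw [← ENNReal.ofReal_sum_of_nonneg, Finset.sum_range_sub (fun i => φ (u i))]
        exact fun i _ => (abs_nonneg _).trans
          (hf _ (hus i) _ (hus (i + 1)) (hu (Nat.le_succ i)))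
    _ ≤ ENNReal.ofReal K := ENNReal.ofReal_le_ofReal (hφ _ (hus 0) _ (hus N))

/-- The real transfer function of one mode is the real part of a partial fraction. -/
theorem mode_eq_re (ξ ζ x t : ℝ) :
    (ζ * t - ξ * x) / (x ^ 2 + t ^ 2) = ((⟨ξ, ζ⟩ : ℂ) / ⟨-x, t⟩).re := by
  rw [Complex.div_re, Complex.normSq_mk]
  ring

theorem abs_mode_sub_le (ξ ζ x : ℝ) {u v : ℝ} (hu : 0 < u) (huv : u ≤ v) :
    |(ζ * v - ξ * x) / (x ^ 2 + v ^ 2) - (ζ * u - ξ * x) / (x ^ 2 + u ^ 2)| ≤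
      √(ξ ^ 2 + ζ ^ 2) * ((v - u) / (u * v)) := by
  have hv : 0 < v := hu.trans_le huv
  have hu0 : (⟨-x, u⟩ : ℂ) ≠ 0 := fun h => hu.ne' (congrArg Complex.im h)
  have hv0 : (⟨-x, v⟩ : ℂ) ≠ 0 := fun h => hv.ne' (congrArg Complex.im h)
  have hun : u ≤ ‖(⟨-x, u⟩ : ℂ)‖ := (le_abs_self u).trans (Complex.abs_im_le_norm ⟨-x, u⟩)
  have hvn : v ≤ ‖(⟨-x, v⟩ : ℂ)‖ := (le_abs_self v).trans (Complex.abs_im_le_norm ⟨-x, v⟩)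
  have hsub : (⟨-x, u⟩ : ℂ) - ⟨-x, v⟩ = -((v - u : ℝ) * Complex.I) := by
    apply Complex.ext <;> simp
  have hdiff : (⟨ξ, ζ⟩ : ℂ) / ⟨-x, v⟩ - ⟨ξ, ζ⟩ / ⟨-x, u⟩ =
      ⟨ξ, ζ⟩ * ((⟨-x, u⟩ - ⟨-x, v⟩) / (⟨-x, u⟩ * ⟨-x, v⟩)) := by
    field_simp
  have hc : ‖(⟨ξ, ζ⟩ : ℂ)‖ = √(ξ ^ 2 + ζ ^ 2) := by
    rw [Complex.norm_def, Complex.normSq_mk, sq, sq]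
  rw [mode_eq_re, mode_eq_re, ← Complex.sub_re]
  refine (Complex.abs_re_le_norm _).trans ?_
  rw [hdiff, norm_mul, hc, norm_div, norm_mul, hsub, norm_neg, norm_mul, Complex.norm_I, mul_one,
    Complex.norm_real, Real.norm_of_nonneg (sub_nonneg.2 huv)]
  have := sub_nonneg.2 huv
  gcongr

/-- Tail total variation bound for a finite sum of modes whose frequencies are at most `M`. -/
theorem eVariationOn_Ici_modes_le {ι : Type*} [Fintype ι] (ξ ζ x y : ι → ℝ) (D : ℝ) {M B : ℝ}
    (hy : ∀ j, y j ≤ M) (hB : M < B) :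
    eVariationOn
        (fun s => ∑ j, (ζ j * (s - y j) - ξ j * x j) / ((x j) ^ 2 + (s - y j) ^ 2) + D)
        (Set.Ici B) ≤
      ENNReal.ofReal (√(∑ j, (ξ j ^ 2 + ζ j ^ 2)) * √(Fintype.card ι) / (B - M)) := by
  set C := √(∑ j, (ξ j ^ 2 + ζ j ^ 2)) * √(Fintype.card ι)
  have hC : 0 ≤ C := by positivity
  have hsum : ∑ j, √(ξ j ^ 2 + ζ j ^ 2) ≤ C := by
    have := Real.sum_mul_le_sqrt_mul_sqrt Finset.univ
      (fun j => √(ξ j ^ 2 + ζ j ^ 2)) (fun _ => 1)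
    simpa [Real.sq_sqrt, add_nonneg, sq_nonneg] using this
  refine eVariationOn_le_of_abs_sub_le (φ := fun s => -(C / (s - M))) ?_ ?_
  · intro a ha b hb hab
    have ha' : 0 < a - M := by linarith [Set.mem_Ici.1 ha]
    have hb' : 0 < b - M := by linarith
    have hba : 0 ≤ b - a := sub_nonneg.2 hab
    rw [add_sub_add_right_eq_sub, ← Finset.sum_sub_distrib]
    calc _ ≤ _ := Finset.abs_sum_le_sum_abs _ _
      _ ≤ ∑ j, √(ξ j ^ 2 + ζ j ^ 2) * ((b - a) / ((a - M) * (b - M))) := by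
          refine Finset.sum_le_sum fun j _ => ?_
          have hj := hy j
          have hay : 0 ≤ a - y j := by linarith
          refine (abs_mode_sub_le (ξ j) (ζ j) (x j) (u := a - y j) (v := b - y j)
            (by linarith) (by linarith)).trans ?_
          rw [sub_sub_sub_cancel_right]
          gcongr
      _ ≤ C * ((b - a) / ((a - M) * (b - M))) := by
          rw [← Finset.sum_mul]
          gcongr
      _ = _ := by
          field_simp
          ring
  · intro a ha b hb
    have hB' : 0 < B - M := sub_pos.2 hB
    have ha' : B - M ≤ a - M := sub_le_sub_right ha M
    have hb' : 0 ≤ C / (b - M) := div_nonneg hC (by linarith [Set.mem_Ici.1 hb])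
    have : C / (a - M) ≤ C / (B - M) := by gcongr
    linarith

/-- Deterministic version of Corollary 3.2: for a HiPPO-initialized diagonal LTI system
with arbitrary coefficients, for every `B > nπ/2` both tail total variations of the real
transfer function are bounded by `‖(ξ,ζ)‖₂ · √n / (B - nπ/2)`. -/
theorem stmt_5 (n : ℕ) (hn : 0 < n) (ξ ζ : Fin n → ℝ) (D : ℝ) (x y : Fin n → ℝ)
    (hxdef : ∀ j, x j = -(1 / 2))
    (hydef : ∀ j : Fin n,
      y j = (-1 : ℝ) ^ ((j : ℕ) + 1) * ((((j : ℕ) + 1) / 2 : ℕ) : ℝ) * π)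
    (G : ℝ → ℝ)
    (hG : ∀ s : ℝ,
      G s = ∑ j, (ζ j * (s - y j) - ξ j * x j) / ((x j) ^ 2 + (s - y j) ^ 2) + D)
    (B : ℝ) (hB : (n : ℝ) * π / 2 < B) :
    eVariationOn G (Set.Iic (-B)) ≤
        ENNReal.ofReal
          (Real.sqrt (∑ j, (ξ j ^ 2 + ζ j ^ 2)) * Real.sqrt n / (B - n * π / 2)) ∧
      eVariationOn G (Set.Ici B) ≤
        ENNReal.ofReal
          (Real.sqrt (∑ j, (ξ j ^ 2 + ζ j ^ 2)) * Real.sqrt n / (B - n * π / 2)) := by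
  have hy : ∀ j, |y j| ≤ n * π / 2 := by
    intro j
    have h : (((((j : ℕ) + 1) / 2 : ℕ) : ℝ)) ≤ n / 2 :=
      Nat.cast_div_le.trans (by
        have : (((j : ℕ) + 1 : ℕ) : ℝ) ≤ n := by exact_mod_cast j.2
        push_cast at this ⊢
        linarith)
    rw [hydef, abs_mul, abs_mul, abs_pow, abs_neg, abs_one, one_pow, one_mul, Nat.abs_cast,
      abs_of_pos pi_pos, mul_div_right_comm]
    gcongr
  obtain rfl : G = _ := funext hG
  constructor
  · have h := eVariationOn_Ici_modes_le ξ (fun j => -ζ j) x (fun j => -y j) D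
      (fun j => (neg_le_abs _).trans (hy j)) hB
    have himage : (fun s : ℝ => -s) '' Set.Ici B = Set.Iic (-B) := by simp
    rw [← himage, ← eVariationOn.comp_eq_of_antitoneOn _ _ (fun _ _ _ _ h => neg_le_neg h)]
    simp only [neg_sq, Fintype.card_fin] at h
    convert h using 2
    funext s
    simp only [Function.comp_apply]
    congr 1
    refine Finset.sum_congr rfl fun j _ => ?_
    ring
  · simpa using eVariationOn_Ici_modes_le ξ ζ x y D (fun j => (le_abs_self _).trans (hy j)) hB
end

section
/- Let x < 0, y > 0, Δt > 0, and let L ≥ 2 be an integer. Then Σ_{j : 0 ≤ j < L/2} 1/(x² + (y − (2/Δt) tan(π j / L))²) ≤ L · [ ((2/π) arctan(y Δt / 4) + 1/L) / (x² + y²/4) + (1 − (2/π) arctan(y Δt / 4) + 1/L) / x² ]. -/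
open Real

theorem Finset.card_le_add_one_of_forall_cast_le {S : Finset ℕ} {c : ℝ} (hc : 0 ≤ c)
    (hS : ∀ j ∈ S, (j : ℝ) ≤ c) : (S.card : ℝ) ≤ c + 1 := by
  have h : S.card ≤ ⌊c⌋₊ + 1 := by
    rw [← Finset.card_range (⌊c⌋₊ + 1)]
    refine Finset.card_le_card fun j hj => ?_
    rw [Finset.mem_range, Nat.lt_succ_iff]
    exact Nat.le_floor (hS j hj)
  have h' : (S.card : ℝ) ≤ ⌊c⌋₊ + 1 := by exact_mod_cast h
  linarith [Nat.floor_le hc]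

theorem Finset.card_le_sub_add_one_of_forall_cast_mem_Ioo {S : Finset ℕ} {c d : ℝ}
    (hc : 0 ≤ c) (hcd : c < d) (hS : ∀ j ∈ S, c < (j : ℝ) ∧ (j : ℝ) < d) :
    (S.card : ℝ) ≤ d - c + 1 := by
  have h : S.card ≤ ⌈d⌉₊ - (⌊c⌋₊ + 1) := by
    rw [← Nat.card_Ico]
    refine Finset.card_le_card fun j hj => ?_
    rw [Finset.mem_Ico]
    exact ⟨(Nat.floor_lt hc).2 (hS j hj).1, Nat.lt_ceil.2 (hS j hj).2⟩
  have hle : ⌊c⌋₊ + 1 ≤ ⌈d⌉₊ := Nat.lt_ceil.2 ((Nat.floor_le hc).trans_lt hcd)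
  have h' : (S.card : ℝ) + (⌊c⌋₊ + 1) ≤ ⌈d⌉₊ := by
    exact_mod_cast (Nat.le_sub_iff_add_le hle).1 h
  linarith [Nat.lt_floor_add_one c, Nat.ceil_lt_add_one (hc.trans hcd.le)]

/-- Bilinear-transform nodes with angle at most `arctan (y * Δt / 4)` have frequency
at most `y / 2`. -/
theorem two_div_mul_tan_le_half {y Δt φ : ℝ} (hΔt : 0 < Δt) (hφ : 0 ≤ φ)
    (h : φ ≤ arctan (y * Δt / 4)) : 2 / Δt * tan φ ≤ y / 2 := by
  have hmem : ∀ ψ : ℝ, 0 ≤ ψ → ψ ≤ arctan (y * Δt / 4) → ψ ∈ Set.Ioo (-(π / 2)) (π / 2) :=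
    fun ψ h0 h1 => ⟨by linarith [pi_pos], h1.trans_lt (arctan_lt_pi_div_two _)⟩
  have htan : tan φ ≤ y * Δt / 4 := by
    rw [← tan_arctan (y * Δt / 4)]
    exact strictMonoOn_tan.monotoneOn (hmem _ hφ h) (hmem _ (hφ.trans h) le_rfl) h
  calc 2 / Δt * tan φ ≤ 2 / Δt * (y * Δt / 4) := by gcongr
    _ = y / 2 := by field_simp; ring

/-- The ℓ² scaling-law bound: the sum of squared sampled transfer-function magnitudes
over the nonnegative-frequency bilinear-transform nodes is bounded by splitting the
nodes at frequency `y/2`. -/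
theorem stmt_15 (x y Δt : ℝ) (hx : x < 0) (hy : 0 < y) (hΔt : 0 < Δt)
    (L : ℕ) (hL : 2 ≤ L) :
    haveI : DecidablePred fun j : ℕ => (j : ℝ) < (L : ℝ) / 2 := Classical.decPred _
    ∑ j ∈ (Finset.range L).filter (fun j : ℕ => (j : ℝ) < (L : ℝ) / 2),
        1 / (x ^ 2 + (y - 2 / Δt * Real.tan (π * j / L)) ^ 2)
      ≤ (L : ℝ) *
        ((2 / π * Real.arctan (y * Δt / 4) + 1 / L) / (x ^ 2 + y ^ 2 / 4)
          + (1 - 2 / π * Real.arctan (y * Δt / 4) + 1 / L) / x ^ 2) := by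
  classical
  have hx2 : 0 < x ^ 2 := sq_pos_of_neg hx
  set θ := arctan (y * Δt / 4)
  have hθ0 : 0 < θ := arctan_pos.2 (by positivity)
  have hθ1 : θ < π / 2 := arctan_lt_pi_div_two _
  have hL0 : (0 : ℝ) < L := by exact_mod_cast (by omega : 0 < L)
  have hπ := pi_pos
  set c : ℝ := L * θ / π with hc
  have hc0 : 0 ≤ c := by positivity
  have hcL : c < (L : ℝ) / 2 := by
    rw [hc, div_lt_div_iff₀ hπ two_pos]
    nlinarith
  rw [← Finset.sum_filter_add_sum_filter_not _ (fun j : ℕ => (j : ℝ) ≤ c), mul_add]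
  refine add_le_add ?_ ?_
  · refine (Finset.sum_le_card_nsmul _ _ (1 / (x ^ 2 + y ^ 2 / 4)) fun j hj => ?_).trans ?_
    · have hj' : (j : ℝ) ≤ L * θ / π := (Finset.mem_filter.1 hj).2
      have hφ : π * j / L ≤ θ := by
        rw [le_div_iff₀ hπ] at hj'
        rw [div_le_iff₀ hL0]
        linarith
      have ht := two_div_mul_tan_le_half hΔt (by positivity) hφ
      refine one_div_le_one_div_of_le (by positivity) ?_
      nlinarith
    · rw [nsmul_eq_mul, mul_one_div, ← mul_div_assoc]
      refine div_le_div_of_nonneg_right ?_ (by positivity)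
      refine (Finset.card_le_add_one_of_forall_cast_le hc0
        fun j hj => (Finset.mem_filter.1 hj).2).trans ?_
      have heq : (L : ℝ) * (2 / π * θ + 1 / L) = 2 * c + 1 := by
        rw [hc]; field_simp
      linarith
  · refine (Finset.sum_le_card_nsmul _ _ (1 / x ^ 2) fun j _ => ?_).trans ?_
    · refine one_div_le_one_div_of_le hx2 ?_
      exact le_add_of_nonneg_right (sq_nonneg _)
    · rw [nsmul_eq_mul, mul_one_div, ← mul_div_assoc]
      refine div_le_div_of_nonneg_right ?_ (by positivity)
      refine (Finset.card_le_sub_add_one_of_forall_cast_mem_Ioo hc0 hcL fun j hj => ?_).trans ?_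
      · have hj' := Finset.mem_filter.1 hj
        exact ⟨not_le.1 hj'.2, (Finset.mem_filter.1 hj'.1).2⟩
      have heq : (L : ℝ) * (1 - 2 / π * θ + 1 / L) = L - 2 * c + 1 := by
        rw [hc]; field_simp
      linarith
end
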